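/- Let A₁, A₂ ∈ ℝ^{n×n}, let θ₁, θ₂ : P → ℝ, and set A(μ) = θ₁(μ)A₁ + θ₂(μ)A₂. Fix μ₀, μ₁, μ ∈ P such that A(μ₀), A(μ₁), and A(μ) are invertible, and assume θ₁(μ₀)θ₂(μ₁) − θ₂(μ₀)θ₁(μ₁) ≠ 0 and θ₁(μ₀)θ₂(μ) − θ₂(μ₀)θ₁(μ) ≠ 0. Let B = A(μ₀)⁻¹, f, r₀* ∈ ℝⁿ, u_μ = A(μ)⁻¹f, and for an integer m ≥ 1 let K_m^μ = K_m(BA(μ), Bf) and L_m^μ = K_m(BᵀA(μ)ᵀ, Bᵀr₀*). Assume there exist symmetric positive definite matrices M, M' ∈ ℝ^{n×n} and constants α, β > 0 such that (A(μ)v, w) ≤ α‖v‖_M‖w‖_{M'} for all v, w ∈ ℝⁿ and inf over nonzero v ∈ K_m^μ of sup over nonzero w ∈ L_m^μ of (A(μ)v, w) / (‖v‖_M‖w‖_{M'}) ≥ β. If û_μ ∈ K_m^{μ₁} satisfies the Petrov–Galerkin equations (A(μ)û_μ, w) = (f, w) for all w ∈ K_m(BᵀA(μ₁)ᵀ, Bᵀr₀*),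 then ‖u_μ − û_μ‖_M ≤ (α/β) · inf over v ∈ K_m^μ of ‖u_μ − v‖_M. -/

import Mathlib

open Matrix

/-- Krylov subspace `K_m(C, v) = span {v, Cv, ..., C^{m-1} v}`. -/
noncomputable def krylov {n : ℕ} (C : Matrix (Fin n) (Fin n) ℝ) (v : Fin n → ℝ) (m : ℕ) :
    Submodule ℝ (Fin n → ℝ) :=
  Submodule.span ℝ {w | ∃ k < m, w = (C ^ k) *ᵥ v}

/-- The `M`-norm `‖v‖_M = √(vᵀ M v)`. -/
noncomputable def mnorm {n : ℕ} (M : Matrix (Fin n) (Fin n) ℝ) (v : Fin n → ℝ) : ℝ :=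
  Real.sqrt (v ⬝ᵥ M *ᵥ v)

theorem krylov_mono {n : ℕ} (C : Matrix (Fin n) (Fin n) ℝ) (v : Fin n → ℝ) {j m : ℕ}
    (h : j ≤ m) : krylov C v j ≤ krylov C v m := by
  apply Submodule.span_mono
  rintro w ⟨k, hk, rfl⟩
  exact ⟨k, by omega, rfl⟩

theorem mulVec_mem_krylov_succ {n : ℕ} (C : Matrix (Fin n) (Fin n) ℝ) (v x : Fin n → ℝ) (m : ℕ)
    (hx : x ∈ krylov C v m) : C *ᵥ x ∈ krylov C v (m + 1) := by
  unfold krylov at hx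
  induction hx using Submodule.span_induction with
  | mem x hx =>
    obtain ⟨k, hk, rfl⟩ := hx
    exact Submodule.subset_span ⟨k + 1, by omega, by rw [mulVec_mulVec, ← pow_succ']⟩
  | zero => simp
  | add x y _ _ hx hy => rw [mulVec_add]; exact add_mem hx hy
  | smul a x _ hx => rw [mulVec_smul]; exact Submodule.smul_mem _ _ hx

theorem affine_pow_mulVec_mem_krylov {n : ℕ} (C : Matrix (Fin n) (Fin n) ℝ) (v : Fin n → ℝ)
    (s t : ℝ) (k : ℕ) : ((s • 1 + t • C) ^ k) *ᵥ v ∈ krylov C v (k + 1) := by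
  induction k with
  | zero => exact Submodule.subset_span ⟨0, by omega, by simp⟩
  | succ k ih =>
    rw [pow_succ', ← mulVec_mulVec, add_mulVec, smul_mulVec, smul_mulVec, one_mulVec]
    exact add_mem (Submodule.smul_mem _ _ (krylov_mono C v (Nat.le_succ _) ih))
      (Submodule.smul_mem _ _ (mulVec_mem_krylov_succ C v _ _ ih))

/-- Krylov subspaces do not grow under an affine change of the matrix. -/
theorem krylov_affine_le {n : ℕ} (C : Matrix (Fin n) (Fin n) ℝ) (v : Fin n → ℝ)
    (s t : ℝ) (m : ℕ) : krylov (s • 1 + t • C) v m ≤ krylov C v m := by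
  refine Submodule.span_le.2 ?_
  rintro w ⟨k, hk, rfl⟩
  exact krylov_mono C v hk (affine_pow_mulVec_mem_krylov C v s t k)

theorem mnorm_sq {n : ℕ} {M : Matrix (Fin n) (Fin n) ℝ} (hM : M.PosDef) (v : Fin n → ℝ) :
    mnorm M v ^ 2 = v ⬝ᵥ M *ᵥ v :=
  Real.sq_sqrt (by simpa using hM.posSemidef.dotProduct_mulVec_nonneg v)

theorem mnorm_nonneg {n : ℕ} (M : Matrix (Fin n) (Fin n) ℝ) (v : Fin n → ℝ) : 0 ≤ mnorm M v :=
  Real.sqrt_nonneg _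

theorem mnorm_pos {n : ℕ} {M : Matrix (Fin n) (Fin n) ℝ} (hM : M.PosDef) {v : Fin n → ℝ}
    (hv : v ≠ 0) : 0 < mnorm M v :=
  Real.sqrt_pos.2 (by simpa using hM.dotProduct_mulVec_pos hv)

theorem mnorm_zero {n : ℕ} (M : Matrix (Fin n) (Fin n) ℝ) : mnorm M 0 = 0 := by
  simp [mnorm]

theorem mnorm_add_smul_sq {n : ℕ} {M : Matrix (Fin n) (Fin n) ℝ} (hM : M.PosDef)
    (x y : Fin n → ℝ) (t : ℝ) :
    mnorm M (x + t • y) ^ 2 = mnorm M x ^ 2 + 2 * t * (x ⬝ᵥ M *ᵥ y) + t ^ 2 * mnorm M y ^ 2 := by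
  have hsymm : y ⬝ᵥ M *ᵥ x = x ⬝ᵥ M *ᵥ y := by
    have hT : Mᵀ = M := by simpa using hM.isHermitian.eq
    rw [dotProduct_mulVec, ← mulVec_transpose, hT, dotProduct_comm]
  simp only [mnorm_sq hM, mulVec_add, mulVec_smul, dotProduct_add, add_dotProduct,
    smul_dotProduct, dotProduct_smul, smul_eq_mul, hsymm]
  ring

/-- The bound `‖x‖ ≤ c ‖x + t y‖` for all `t` is symmetric in the directions of `x` and `y`:
it depends only on the angle between them. -/
theorem mnorm_le_of_forall_mnorm_le {n : ℕ} {M : Matrix (Fin n) (Fin n) ℝ} (hM : M.PosDef)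
    {x y : Fin n → ℝ} (hx : x ≠ 0) {c : ℝ} (hc : 0 ≤ c)
    (h : ∀ t : ℝ, mnorm M x ≤ c * mnorm M (x + t • y)) :
    mnorm M y ≤ c * mnorm M (x + y) := by
  rcases eq_or_ne y 0 with rfl | hy
  · rw [mnorm_zero]
    exact mul_nonneg hc (mnorm_nonneg _ _)
  have hsum := mnorm_add_smul_sq hM x y 1
  rw [one_smul] at hsum
  have ht := pow_le_pow_left₀ (mnorm_nonneg M x) (h (-(x ⬝ᵥ M *ᵥ y) / mnorm M y ^ 2)) 2
  rw [mul_pow, mnorm_add_smul_sq hM] at ht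
  have hxp := mnorm_pos hM hx
  have hyp := mnorm_pos hM hy
  refine (sq_le_sq₀ (mnorm_nonneg _ _) (mul_nonneg hc (mnorm_nonneg _ _))).1 ?_
  rw [mul_pow, hsum]
  generalize x ⬝ᵥ M *ᵥ y = b at *
  have hap : 0 < mnorm M x ^ 2 := by positivity
  have hcp : 0 < mnorm M y ^ 2 := by positivity
  generalize mnorm M x ^ 2 = p at *
  generalize mnorm M y ^ 2 = q at *
  have hpq : p * q ≤ c ^ 2 * (p * q - b ^ 2) := by
    have := mul_le_mul_of_nonneg_right ht hcp.le
    have he : c ^ 2 * (p + 2 * (-b / q) * b + (-b / q) ^ 2 * q) * q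
        = c ^ 2 * (p * q - b ^ 2) := by
      field_simp
      ring
    rwa [he] at this
  refine le_of_mul_le_mul_left (hpq.trans ?_) hap
  have := mul_nonneg (sq_nonneg c) (sq_nonneg (p + b))
  linarith

/-- A member of a two-parameter pencil is a combination of any two independent members. -/
theorem exists_eq_smul_add_smul_of_det_ne_zero {V : Type*} [AddCommGroup V] [Module ℝ V]
    (x y : V) {a b c d : ℝ} (h : a * d - b * c ≠ 0) (p q : ℝ) :
    ∃ s t : ℝ, p • x + q • y = s • (a • x + b • y) + t • (c • x + d • y) := by
  refine ⟨(p * d - q * c) / (a * d - b * c), (a * q - b * p) / (a * d - b * c), ?_⟩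
  have hp : p = (p * d - q * c) / (a * d - b * c) * a + (a * q - b * p) / (a * d - b * c) * c := by
    rw [div_mul_eq_mul_div, div_mul_eq_mul_div, ← add_div, eq_div_iff h]
    ring
  have hq : q = (p * d - q * c) / (a * d - b * c) * b + (a * q - b * p) / (a * d - b * c) * d := by
    rw [div_mul_eq_mul_div, div_mul_eq_mul_div, ← add_div, eq_div_iff h]
    ring
  generalize (p * d - q * c) / (a * d - b * c) = s at *
  generalize (a * q - b * p) / (a * d - b * c) = t at *
  rw [hp, hq]
  module

theorem stmt11 {n : ℕ} {P : Type*}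
    (A₁ A₂ : Matrix (Fin n) (Fin n) ℝ) (θ₁ θ₂ : P → ℝ)
    (A : P → Matrix (Fin n) (Fin n) ℝ)
    (hA : ∀ μ', A μ' = θ₁ μ' • A₁ + θ₂ μ' • A₂)
    (μ₀ μ₁ μ : P)
    (h0 : IsUnit (A μ₀)) (h1 : IsUnit (A μ₁)) (hμ : IsUnit (A μ))
    (hdet1 : θ₁ μ₀ * θ₂ μ₁ - θ₂ μ₀ * θ₁ μ₁ ≠ 0)
    (hdet2 : θ₁ μ₀ * θ₂ μ - θ₂ μ₀ * θ₁ μ ≠ 0)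
    (B : Matrix (Fin n) (Fin n) ℝ) (hB : B = (A μ₀)⁻¹)
    (f r₀s u : Fin n → ℝ) (hu : u = (A μ)⁻¹ *ᵥ f)
    (m : ℕ) (hm : 1 ≤ m)
    (M M' : Matrix (Fin n) (Fin n) ℝ) (hM : M.PosDef) (hM' : M'.PosDef)
    (α β : ℝ) (hαpos : 0 < α) (hβpos : 0 < β)
    -- boundedness: `(A(μ)v, w) ≤ α ‖v‖_M ‖w‖_{M'}`
    (hα : ∀ v w : Fin n → ℝ, w ⬝ᵥ (A μ) *ᵥ v ≤ α * mnorm M v * mnorm M' w)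
    -- inf-sup over `K_m^μ` and `L_m^μ`
    (hβ : ∀ v ∈ krylov (B * A μ) (B *ᵥ f) m, v ≠ 0 →
      ∃ w ∈ krylov (Bᵀ * (A μ)ᵀ) (Bᵀ *ᵥ r₀s) m, w ≠ 0 ∧
        β * (mnorm M v * mnorm M' w) ≤ w ⬝ᵥ (A μ) *ᵥ v)
    (uhat : Fin n → ℝ)
    -- Petrov–Galerkin solution in `K_m^{μ₁}` tested against `L_m^{μ₁}`
    (huhat : uhat ∈ krylov (B * A μ₁) (B *ᵥ f) m)
    (hpg : ∀ w ∈ krylov (Bᵀ * (A μ₁)ᵀ) (Bᵀ *ᵥ r₀s) m,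
      w ⬝ᵥ (A μ) *ᵥ uhat = f ⬝ᵥ w) :
    ∀ v ∈ krylov (B * A μ) (B *ᵥ f) m,
      mnorm M (u - uhat) ≤ (α / β) * mnorm M (u - v) := by
  have hdet := (Matrix.isUnit_iff_isUnit_det _).1 h0
  have hBA : B * A μ₀ = 1 := by rw [hB, nonsing_inv_mul _ hdet]
  have hAB : A μ₀ * B = 1 := by rw [hB, mul_nonsing_inv _ hdet]
  have hK : uhat ∈ krylov (B * A μ) (B *ᵥ f) m := by
    obtain ⟨s, t, hst⟩ :=
      exists_eq_smul_add_smul_of_det_ne_zero A₁ A₂ hdet2 (θ₁ μ₁) (θ₂ μ₁)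
    rw [← hA, ← hA, ← hA] at hst
    rw [hst, mul_add, mul_smul_comm, mul_smul_comm, hBA] at huhat
    exact krylov_affine_le _ _ _ _ _ huhat
  have hL : krylov (Bᵀ * (A μ)ᵀ) (Bᵀ *ᵥ r₀s) m ≤ krylov (Bᵀ * (A μ₁)ᵀ) (Bᵀ *ᵥ r₀s) m := by
    obtain ⟨s, t, hst⟩ :=
      exists_eq_smul_add_smul_of_det_ne_zero A₁ A₂ hdet1 (θ₁ μ) (θ₂ μ)
    rw [← hA, ← hA, ← hA] at hst
    rw [hst, transpose_add, transpose_smul, transpose_smul, mul_add, mul_smul_comm,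
      mul_smul_comm, ← transpose_mul, hAB, transpose_one]
    exact krylov_affine_le _ _ _ _ _
  have hAu : A μ *ᵥ u = f := by
    rw [hu, mulVec_mulVec, mul_nonsing_inv _ ((Matrix.isUnit_iff_isUnit_det _).1 hμ), one_mulVec]
  have horth : ∀ w ∈ krylov (Bᵀ * (A μ)ᵀ) (Bᵀ *ᵥ r₀s) m, w ⬝ᵥ A μ *ᵥ (u - uhat) = 0 := by
    intro w hw
    rw [mulVec_sub, dotProduct_sub, hAu, hpg w (hL hw), dotProduct_comm, sub_self]
  have hbound : ∀ x ∈ krylov (B * A μ) (B *ᵥ f) m, x ≠ 0 → ∀ t : ℝ,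
      mnorm M x ≤ α / β * mnorm M (x + t • (u - uhat)) := by
    intro x hx hx0 t
    obtain ⟨w, hw, hw0, hle⟩ := hβ x hx hx0
    have hup := hα (x + t • (u - uhat)) w
    rw [mulVec_add, mulVec_smul, dotProduct_add, dotProduct_smul, horth w hw, smul_zero,
      add_zero] at hup
    have hwp := mnorm_pos hM' hw0
    rw [div_mul_eq_mul_div, le_div_iff₀ hβpos]
    refine le_of_mul_le_mul_right ?_ hwp
    linarith
  intro v hv
  have hc : 0 ≤ α / β := by positivity
  rcases eq_or_ne uhat v with rfl | hne
  · have hle : ∀ x ∈ krylov (B * A μ) (B *ᵥ f) m, x ≠ 0 →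
        mnorm M (u - uhat) ≤ α / β * mnorm M (u - uhat) := by
      intro x hx hx0
      have h := hbound x hx hx0 0
      rw [zero_smul, add_zero] at h
      exact le_mul_of_one_le_left (mnorm_nonneg _ _)
        ((le_mul_iff_one_le_left (mnorm_pos hM hx0)).1 h)
    by_cases huhat0 : uhat = 0
    · by_cases hf : B *ᵥ f = 0
      · have hf0 : f = 0 := by
          rw [← one_mulVec f, ← hAB, ← mulVec_mulVec, hf, mulVec_zero]
        have hu0 : u = 0 := by rw [hu, hf0, mulVec_zero]
        simp [hu0, huhat0, mnorm_zero]
      · exact hle _ (Submodule.subset_span ⟨0, hm, by simp⟩) hf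
    · exact hle _ hK huhat0
  · have hx0 : uhat - v ≠ 0 := sub_ne_zero.2 hne
    have := mnorm_le_of_forall_mnorm_le hM hx0 hc (hbound _ (sub_mem hK hv) hx0)
    rwa [show uhat - v + (u - uhat) = u - v by abel] at this
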